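/- arXiv:1308.0895 — 3 statements merged into one kernel-verified Lean document; each statement's English description precedes it below -/
import Mathlib

section
/- Let H be a partial subgroup of G = E·D with support F = E ∩ H. The following are equivalent: (a) Ha = aH for all a ∈ G (H is a normal partial subgroup); (b) a*.h.a ∈ F for all a ∈ G, all h ∈ H and all a* ∈ Inv(a); (c) x⁻¹*F*x = F for all x ∈ E (F is a normal subgroup of E). -/
namespace PartialGroup

variable {Γ : Type*} [Group Γ]

/-- The set `E·D = {x*d : x ∈ E, d ∈ D}`. -/
def prodSet (E : Subgroup Γ) (D : Set Γ) : Set Γ :=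
  {g | ∃ x ∈ E, ∃ d ∈ D, g = x * d}

/-- For `a = x*d ∈ G` (unique decomposition, `x ∈ E`, `d ∈ D`),
`Inv(a) = {x⁻¹*d' : d' ∈ D}`. -/
def invSet (E : Subgroup Γ) (D : Set Γ) (a : Γ) : Set Γ :=
  {g | ∃ x ∈ E, ∃ d ∈ D, a = x * d ∧ ∃ d' ∈ D, g = x⁻¹ * d'}

/-- `H` is a partial subgroup of the partial group `G = E·D` with partial law `pmul`. -/
def IsPartialSubgroup (E : Subgroup Γ) (D : Set Γ) (pmul : Γ → Γ → Γ) (H : Set Γ) : Prop :=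
  H ⊆ prodSet E D ∧ (1 : Γ) ∈ H ∧ (∀ a ∈ H, ∀ b ∈ H, pmul a b ∈ H) ∧
    ∀ a ∈ H, (invSet E D a ∩ H).Nonempty

/-- The left coset `aH = {a.h : h ∈ H}` for the partial law `pmul`. -/
def lcoset (pmul : Γ → Γ → Γ) (a : Γ) (H : Set Γ) : Set Γ :=
  {g | ∃ h ∈ H, g = pmul a h}

/-- The right coset `Ha = {h.a : h ∈ H}` for the partial law `pmul`. -/
def rcoset (pmul : Γ → Γ → Γ) (a : Γ) (H : Set Γ) : Set Γ :=
  {g | ∃ h ∈ H, g = pmul h a}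

/-- The `E`-component of an element of a partial subgroup lies in the partial subgroup. -/
theorem IsPartialSubgroup.left_mem {E : Subgroup Γ} {D : Set Γ} {pmul : Γ → Γ → Γ} {H : Set Γ}
    (hH : IsPartialSubgroup E D pmul H) (hD1 : (1 : Γ) ∈ D)
    (hpmul : ∀ x ∈ E, ∀ d ∈ D, ∀ y ∈ E, ∀ d' ∈ D, pmul (x * d) (y * d') = x * y)
    {y d : Γ} (hy : y ∈ E) (hd : d ∈ D) (hyd : y * d ∈ H) : y ∈ H := by
  have h := hH.2.2.1 _ hyd 1 hH.2.1
  have e := hpmul y hy d hd 1 E.one_mem 1 hD1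
  rw [mul_one, mul_one] at e
  rwa [e] at h

/-- The left coset of `x * d` by a partial subgroup `H` is `x * (E ∩ H)`. -/
theorem mem_lcoset_iff {E : Subgroup Γ} {D : Set Γ} {pmul : Γ → Γ → Γ} {H : Set Γ}
    (hH : IsPartialSubgroup E D pmul H) (hD1 : (1 : Γ) ∈ D)
    (hpmul : ∀ x ∈ E, ∀ d ∈ D, ∀ y ∈ E, ∀ d' ∈ D, pmul (x * d) (y * d') = x * y)
    {x d : Γ} (hx : x ∈ E) (hd : d ∈ D) (g : Γ) :
    g ∈ lcoset pmul (x * d) H ↔ ∃ y ∈ (E : Set Γ) ∩ H, g = x * y := by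
  constructor
  · rintro ⟨h, hh, rfl⟩
    obtain ⟨y, hy, c, hc, rfl⟩ := hH.1 hh
    exact ⟨y, ⟨hy, hH.left_mem hD1 hpmul hy hc hh⟩, hpmul x hx d hd y hy c hc⟩
  · rintro ⟨y, ⟨hy, hyH⟩, rfl⟩
    refine ⟨y, hyH, ?_⟩
    simpa using (hpmul x hx d hd y hy 1 hD1).symm

/-- The right coset of `x * d` by a partial subgroup `H` is `(E ∩ H) * x`. -/
theorem mem_rcoset_iff {E : Subgroup Γ} {D : Set Γ} {pmul : Γ → Γ → Γ} {H : Set Γ}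
    (hH : IsPartialSubgroup E D pmul H) (hD1 : (1 : Γ) ∈ D)
    (hpmul : ∀ x ∈ E, ∀ d ∈ D, ∀ y ∈ E, ∀ d' ∈ D, pmul (x * d) (y * d') = x * y)
    {x d : Γ} (hx : x ∈ E) (hd : d ∈ D) (g : Γ) :
    g ∈ rcoset pmul (x * d) H ↔ ∃ y ∈ (E : Set Γ) ∩ H, g = y * x := by
  constructor
  · rintro ⟨h, hh, rfl⟩
    obtain ⟨y, hy, c, hc, rfl⟩ := hH.1 hh
    exact ⟨y, ⟨hy, hH.left_mem hD1 hpmul hy hc hh⟩, hpmul y hy c hc x hx d hd⟩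
  · rintro ⟨y, ⟨hy, hyH⟩, rfl⟩
    refine ⟨y, hyH, ?_⟩
    simpa using (hpmul y hy 1 hD1 x hx d hd).symm

/-- The product `a*.h.a` is the conjugate of the `E`-component of `h` by that of `a`. -/
theorem pmul_pmul_inv_mul {E : Subgroup Γ} {D : Set Γ} {pmul : Γ → Γ → Γ} (hD1 : (1 : Γ) ∈ D)
    (hpmul : ∀ x ∈ E, ∀ d ∈ D, ∀ y ∈ E, ∀ d' ∈ D, pmul (x * d) (y * d') = x * y)
    {x d d' y c : Γ} (hx : x ∈ E) (hd : d ∈ D) (hd' : d' ∈ D) (hy : y ∈ E) (hc : c ∈ D) :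
    pmul (pmul (x⁻¹ * d') (y * c)) (x * d) = x⁻¹ * y * x := by
  rw [hpmul _ (E.inv_mem hx) _ hd' _ hy _ hc]
  simpa using hpmul _ (E.mul_mem (E.inv_mem hx) hy) 1 hD1 x hx d hd

/-- Let `H` be a partial subgroup of `G = E·D` with support `F = E ∩ H`.
The following are equivalent:
(a) `Ha = aH` for all `a ∈ G` (`H` is a normal partial subgroup);
(b) `a*.h.a ∈ F` for all `a ∈ G`, all `h ∈ H` and all `a* ∈ Inv(a)`;
(c) `x⁻¹*F*x = F` for all `x ∈ E` (`F` is a normal subgroup of `E`). -/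
theorem normal_partialSubgroup_tfae
    (E Dt : Subgroup Γ)
    (hint : (E : Set Γ) ∩ (Dt : Set Γ) = {1})
    (hsupp : ∀ g : Γ, ∃ x ∈ E, ∃ d ∈ Dt, g = x * d)
    (D : Set Γ) (hD1 : (1 : Γ) ∈ D) (hDsub : D ⊆ (Dt : Set Γ))
    (pmul : Γ → Γ → Γ)
    (hpmul : ∀ x ∈ E, ∀ d ∈ D, ∀ y ∈ E, ∀ d' ∈ D, pmul (x * d) (y * d') = x * y)
    (H : Set Γ) (hH : IsPartialSubgroup E D pmul H) :
    [(∀ a ∈ prodSet E D, rcoset pmul a H = lcoset pmul a H),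
     (∀ a ∈ prodSet E D, ∀ h ∈ H, ∀ as ∈ invSet E D a,
        pmul (pmul as h) a ∈ (E : Set Γ) ∩ H),
     (∀ x ∈ E, {g | ∃ y ∈ (E : Set Γ) ∩ H, g = x⁻¹ * y * x} = (E : Set Γ) ∩ H)].TFAE := by
  tfae_have 1 → 2 := by
    rintro ha _ - h hh _ ⟨x, hx, d, hd, rfl, d', hd', rfl⟩
    obtain ⟨y, hy, c, hc, rfl⟩ := hH.1 hh
    rw [pmul_pmul_inv_mul hD1 hpmul hx hd hd' hy hc]
    have hmem : y * x ∈ rcoset pmul (x * d) H :=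
      (mem_rcoset_iff hH hD1 hpmul hx hd _).2 ⟨y, ⟨hy, hH.left_mem hD1 hpmul hy hc hh⟩, rfl⟩
    rw [ha _ ⟨x, hx, d, hd, rfl⟩, mem_lcoset_iff hH hD1 hpmul hx hd] at hmem
    obtain ⟨z, hz, hyz⟩ := hmem
    rwa [mul_assoc, hyz, inv_mul_cancel_left]
  tfae_have 2 → 3 := by
    intro hb
    have hconj : ∀ x ∈ E, ∀ y ∈ (E : Set Γ) ∩ H, x⁻¹ * y * x ∈ (E : Set Γ) ∩ H := by
      rintro x hx y ⟨hy, hyH⟩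
      have h := hb (x * 1) ⟨x, hx, 1, hD1, rfl⟩ (y * 1) (by rwa [mul_one]) (x⁻¹ * 1)
        ⟨x, hx, 1, hD1, rfl, 1, hD1, rfl⟩
      rwa [pmul_pmul_inv_mul hD1 hpmul hx hD1 hD1 hy hD1] at h
    intro x hx
    ext g
    constructor
    · rintro ⟨y, hy, rfl⟩
      exact hconj x hx y hy
    · intro hg
      exact ⟨x⁻¹⁻¹ * g * x⁻¹, hconj x⁻¹ (E.inv_mem hx) g hg, by group⟩
  tfae_have 3 → 1 := by
    rintro hc _ ⟨x, hx, d, hd, rfl⟩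
    ext g
    rw [mem_rcoset_iff hH hD1 hpmul hx hd, mem_lcoset_iff hH hD1 hpmul hx hd]
    constructor
    · rintro ⟨y, hy, rfl⟩
      exact ⟨x⁻¹ * y * x, (hc x hx).subset ⟨y, hy, rfl⟩, by group⟩
    · rintro ⟨y, hy, rfl⟩
      obtain ⟨z, hz, rfl⟩ := (hc x hx).superset hy
      exact ⟨z, hz, by group⟩
  tfae_finish

end PartialGroup
end

section
/- Let N be a normal partial subgroup of G = E·D. If a ~_N a' and b ~_N b', then a.b ~_N a'.b'. Consequently the operation [a]*[b] := [a.b] is well defined on the quotient G/~_N and makes it a group, with identity the class of e and with the class of any element of Inv(a) inverse to the class of a. -/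
namespace PartialGroup

variable {Γ : Type*} [Group Γ]

/-- The congruence `a ~_N b` iff `a.e = b.h` for some `h ∈ N`, as a relation on
(the subtype of) the carrier set `S` of the partial group. -/
def simRelN (pmul : Γ → Γ → Γ) (N : Set Γ) (S : Set Γ) (a b : ↥S) : Prop :=
  ∃ h ∈ N, pmul (a : Γ) 1 = pmul (b : Γ) h

/-- `IsPartialLaw E D pmul` says that `pmul` is the law of the partial group `E·D`. -/
def IsPartialLaw (E : Subgroup Γ) (D : Set Γ) (pmul : Γ → Γ → Γ) : Prop :=
  ∀ x ∈ E, ∀ d ∈ D, ∀ y ∈ E, ∀ d' ∈ D, pmul (x * d) (y * d') = x * y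

section Law

variable {E : Subgroup Γ} {D : Set Γ} {pmul : Γ → Γ → Γ}

theorem mem_prodSet_of_mem (hD1 : (1 : Γ) ∈ D) {x : Γ} (hx : x ∈ E) : x ∈ prodSet E D :=
  ⟨x, hx, 1, hD1, (mul_one x).symm⟩

theorem IsPartialLaw.mul_defect_one (h : IsPartialLaw E D pmul) (hD1 : (1 : Γ) ∈ D) {x d : Γ}
    (hx : x ∈ E) (hd : d ∈ D) : pmul (x * d) 1 = x := by
  simpa using h x hx d hd 1 E.one_mem 1 hD1

theorem IsPartialLaw.apply_one (h : IsPartialLaw E D pmul) (hD1 : (1 : Γ) ∈ D) {x : Γ}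
    (hx : x ∈ E) : pmul x 1 = x := by
  simpa using h.mul_defect_one hD1 hx hD1

theorem IsPartialLaw.apply_one_mem (h : IsPartialLaw E D pmul) (hD1 : (1 : Γ) ∈ D) {a : Γ}
    (ha : a ∈ prodSet E D) : pmul a 1 ∈ E := by
  obtain ⟨x, hx, d, hd, rfl⟩ := ha
  rwa [h.mul_defect_one hD1 hx hd]

/-- The partial law multiplies the components in the support. -/
theorem IsPartialLaw.apply_eq (h : IsPartialLaw E D pmul) (hD1 : (1 : Γ) ∈ D) {a b : Γ}
    (ha : a ∈ prodSet E D) (hb : b ∈ prodSet E D) : pmul a b = pmul a 1 * pmul b 1 := by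
  obtain ⟨x, hx, d, hd, rfl⟩ := ha
  obtain ⟨y, hy, d', hd', rfl⟩ := hb
  rw [h.mul_defect_one hD1 hx hd, h.mul_defect_one hD1 hy hd', h x hx d hd y hy d' hd']

/-- The projection of `E·D` onto its support. -/
def supportProj (h : IsPartialLaw E D pmul) (hD1 : (1 : Γ) ∈ D) (a : prodSet E D) : E :=
  ⟨pmul a 1, h.apply_one_mem hD1 a.2⟩

theorem supportProj_of_mem (h : IsPartialLaw E D pmul) (hD1 : (1 : Γ) ∈ D) (x : E)
    (hx : (x : Γ) ∈ prodSet E D) : supportProj h hD1 ⟨x, hx⟩ = x :=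
  Subtype.ext (h.apply_one hD1 x.2)

theorem IsPartialLaw.apply_eq_coe (h : IsPartialLaw E D pmul) (hD1 : (1 : Γ) ∈ D)
    (a b : prodSet E D) :
    pmul (a : Γ) b = ((supportProj h hD1 a * supportProj h hD1 b : E) : Γ) :=
  h.apply_eq hD1 a.2 b.2

theorem IsPartialLaw.apply_mem (h : IsPartialLaw E D pmul) (hD1 : (1 : Γ) ∈ D)
    (a b : prodSet E D) : pmul (a : Γ) b ∈ prodSet E D := by
  rw [h.apply_eq_coe hD1]
  exact mem_prodSet_of_mem hD1 (SetLike.coe_mem _)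

theorem supportProj_apply (h : IsPartialLaw E D pmul) (hD1 : (1 : Γ) ∈ D)
    (a b : prodSet E D) (hab : pmul (a : Γ) b ∈ prodSet E D) :
    supportProj h hD1 ⟨pmul (a : Γ) b, hab⟩ = supportProj h hD1 a * supportProj h hD1 b := by
  simp only [h.apply_eq_coe hD1 a b]
  exact supportProj_of_mem h hD1 _ _

theorem supportProj_of_mem_invSet (h : IsPartialLaw E D pmul) (hD1 : (1 : Γ) ∈ D)
    (a b : prodSet E D) (hb : (b : Γ) ∈ invSet E D a) :
    supportProj h hD1 b = (supportProj h hD1 a)⁻¹ := by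
  obtain ⟨x, hx, d, hd, hax, d', hd', hbx⟩ := hb
  apply Subtype.ext
  simp only [supportProj, hax, hbx, InvMemClass.coe_inv]
  rw [h.mul_defect_one hD1 hx hd, h.mul_defect_one hD1 (E.inv_mem hx) hd']

variable {N : Set Γ}

/-- The elements of the support lying in a partial subgroup form a subgroup of the support. -/
def supportSubgroup (h : IsPartialLaw E D pmul) (hD1 : (1 : Γ) ∈ D)
    (hN : IsPartialSubgroup E D pmul N) : Subgroup E where
  carrier := {x | (x : Γ) ∈ N}
  one_mem' := hN.2.1
  mul_mem' {x y} hx hy := by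
    have := hN.2.2.1 x hx y hy
    rwa [h.apply_eq hD1 (hN.1 hx) (hN.1 hy), h.apply_one hD1 x.2, h.apply_one hD1 y.2] at this
  inv_mem' {x} hx := by
    obtain ⟨b, hb, hbN⟩ := hN.2.2.2 x hx
    have hinv := supportProj_of_mem_invSet h hD1 ⟨x, hN.1 hx⟩ ⟨b, hN.1 hbN⟩ hb
    rw [supportProj_of_mem] at hinv
    change ((x⁻¹ : E) : Γ) ∈ N
    rw [← hinv]
    exact hN.2.2.1 b hbN 1 hN.2.1

theorem supportProj_mem_supportSubgroup (h : IsPartialLaw E D pmul) (hD1 : (1 : Γ) ∈ D)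
    (hN : IsPartialSubgroup E D pmul N) (a : prodSet E D) (ha : (a : Γ) ∈ N) :
    supportProj h hD1 a ∈ supportSubgroup h hD1 hN :=
  hN.2.2.1 a ha 1 hN.2.1

theorem supportSubgroup_normal (h : IsPartialLaw E D pmul) (hD1 : (1 : Γ) ∈ D)
    (hN : IsPartialSubgroup E D pmul N)
    (hnormal : ∀ a ∈ prodSet E D, lcoset pmul a N = rcoset pmul a N) :
    (supportSubgroup h hD1 hN).Normal where
  conj_mem n hn g := by
    have hg := mem_prodSet_of_mem hD1 g.2
    have hmem : pmul (g : Γ) n ∈ rcoset pmul (g : Γ) N := hnormal g hg ▸ ⟨n, hn, rfl⟩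
    obtain ⟨k, hk, hgk⟩ := hmem
    have hkey := supportProj_mem_supportSubgroup h hD1 hN ⟨k, hN.1 hk⟩ hk
    have heq : g * n = supportProj h hD1 ⟨k, hN.1 hk⟩ * g := by
      apply Subtype.ext
      have := h.apply_eq_coe hD1 ⟨k, hN.1 hk⟩ ⟨g, hg⟩
      rw [supportProj_of_mem] at this
      rw [← this, ← hgk, h.apply_eq hD1 hg (hN.1 hn), h.apply_one hD1 g.2,
        h.apply_one hD1 n.2, Subgroup.coe_mul]
    rwa [heq, mul_inv_cancel_right]

theorem simRelN_iff (h : IsPartialLaw E D pmul) (hD1 : (1 : Γ) ∈ D)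
    (hN : IsPartialSubgroup E D pmul N) (a b : prodSet E D) :
    simRelN pmul N (prodSet E D) a b ↔
      (supportProj h hD1 a : E ⧸ supportSubgroup h hD1 hN) = supportProj h hD1 b := by
  rw [eq_comm, QuotientGroup.eq]
  constructor
  · rintro ⟨k, hk, hak⟩
    have heq : supportProj h hD1 a = supportProj h hD1 b * supportProj h hD1 ⟨k, hN.1 hk⟩ :=
      Subtype.ext (hak.trans (h.apply_eq_coe hD1 b ⟨k, hN.1 hk⟩))
    rw [heq, inv_mul_cancel_left]
    exact supportProj_mem_supportSubgroup h hD1 hN _ hk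
  · intro hmem
    refine ⟨_, hmem, ?_⟩
    have := h.apply_eq_coe hD1 b ⟨_, hN.1 hmem⟩
    rw [supportProj_of_mem, mul_inv_cancel_left] at this
    exact this.symm

/-- The quotient of `E·D` by `~_N` is in bijection with a quotient of the support. -/
noncomputable def quotEquiv (h : IsPartialLaw E D pmul) (hD1 : (1 : Γ) ∈ D)
    (hN : IsPartialSubgroup E D pmul N) :
    Quot (simRelN pmul N (prodSet E D)) ≃ E ⧸ supportSubgroup h hD1 hN :=
  Equiv.ofBijective
    (Quot.lift (fun a => (supportProj h hD1 a : E ⧸ supportSubgroup h hD1 hN))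
      fun a b hab => (simRelN_iff h hD1 hN a b).1 hab) <| by
    constructor
    · rintro ⟨a⟩ ⟨b⟩ hab
      exact Quot.sound ((simRelN_iff h hD1 hN a b).2 hab)
    · intro q
      obtain ⟨x, rfl⟩ := QuotientGroup.mk_surjective q
      exact ⟨Quot.mk _ ⟨x, mem_prodSet_of_mem hD1 x.2⟩,
        congrArg QuotientGroup.mk (supportProj_of_mem h hD1 x _)⟩

theorem quotEquiv_mk (h : IsPartialLaw E D pmul) (hD1 : (1 : Γ) ∈ D)
    (hN : IsPartialSubgroup E D pmul N) (a : prodSet E D) :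
    quotEquiv h hD1 hN (Quot.mk _ a) = (supportProj h hD1 a : E ⧸ supportSubgroup h hD1 hN) :=
  rfl

end Law

/-- Let `N` be a normal partial subgroup of `G = E·D`. If `a ~_N a'` and
`b ~_N b'`, then `a.b ~_N a'.b'`. Consequently `[a]*[b] := [a.b]` is well defined on the
quotient `G/~_N` and makes it a group, with identity the class of `e` and with the class of
any element of `Inv(a)` inverse to the class of `a`. -/
theorem quotient_by_normal_is_group
    (E Dt : Subgroup Γ)
    (hint : (E : Set Γ) ∩ (Dt : Set Γ) = {1})
    (hsupp : ∀ g : Γ, ∃ x ∈ E, ∃ d ∈ Dt, g = x * d)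
    (D : Set Γ) (hD1 : (1 : Γ) ∈ D) (hDsub : D ⊆ (Dt : Set Γ))
    (pmul : Γ → Γ → Γ)
    (hpmul : ∀ x ∈ E, ∀ d ∈ D, ∀ y ∈ E, ∀ d' ∈ D, pmul (x * d) (y * d') = x * y)
    (N : Set Γ) (hN : IsPartialSubgroup E D pmul N)
    (hNnormal : ∀ a ∈ prodSet E D, lcoset pmul a N = rcoset pmul a N) :
    -- the congruence is compatible with the partial law
    (∀ a ∈ prodSet E D, ∀ a' ∈ prodSet E D, ∀ b ∈ prodSet E D, ∀ b' ∈ prodSet E D,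
      (∃ h ∈ N, pmul a 1 = pmul a' h) → (∃ h ∈ N, pmul b 1 = pmul b' h) →
      ∃ h ∈ N, pmul (pmul a b) 1 = pmul (pmul a' b') h) ∧
    -- hence `[a]*[b] := [a.b]` is well defined on `G/~_N` and makes it a group
    ∃ (mul : Quot (simRelN pmul N (prodSet E D)) → Quot (simRelN pmul N (prodSet E D)) →
        Quot (simRelN pmul N (prodSet E D)))
      (one : Quot (simRelN pmul N (prodSet E D)))
      (inv : Quot (simRelN pmul N (prodSet E D)) → Quot (simRelN pmul N (prodSet E D))),
      (∀ (a b : ↥(prodSet E D)) (hab : pmul (a : Γ) (b : Γ) ∈ prodSet E D),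
        mul (Quot.mk _ a) (Quot.mk _ b) = Quot.mk _ ⟨pmul (a : Γ) (b : Γ), hab⟩) ∧
      (∀ p q r, mul (mul p q) r = mul p (mul q r)) ∧
      (∀ p, mul one p = p) ∧ (∀ p, mul p one = p) ∧
      (∀ p, mul (inv p) p = one) ∧ (∀ p, mul p (inv p) = one) ∧
      -- the identity is the class of `e`
      one = Quot.mk _ (⟨1, 1, E.one_mem, 1, hD1, (mul_one 1).symm⟩ : ↥(prodSet E D)) ∧
      -- the class of any element of `Inv(a)` is the inverse of the class of `a`
      (∀ (a : ↥(prodSet E D)), ∀ as ∈ invSet E D (a : Γ), ∀ has : as ∈ prodSet E D,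
        inv (Quot.mk _ a) = Quot.mk _ (⟨as, has⟩ : ↥(prodSet E D))) := by
  have h : IsPartialLaw E D pmul := hpmul
  have hnormal := supportSubgroup_normal h hD1 hN hNnormal
  let φ := quotEquiv h hD1 hN
  refine ⟨?_, fun p q => φ.symm (φ p * φ q), φ.symm 1, fun p => φ.symm (φ p)⁻¹,
    ?_, ?_, ?_, ?_, ?_, ?_, ?_, ?_⟩
  · intro a ha a' ha' b hb b' hb' haa' hbb'
    have hA := (simRelN_iff h hD1 hN ⟨a, ha⟩ ⟨a', ha'⟩).1 haa'
    have hB := (simRelN_iff h hD1 hN ⟨b, hb⟩ ⟨b', hb'⟩).1 hbb'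
    refine (simRelN_iff h hD1 hN ⟨_, h.apply_mem hD1 ⟨a, ha⟩ ⟨b, hb⟩⟩
      ⟨_, h.apply_mem hD1 ⟨a', ha'⟩ ⟨b', hb'⟩⟩).2 ?_
    rw [supportProj_apply, supportProj_apply, QuotientGroup.mk_mul, QuotientGroup.mk_mul, hA, hB]
  · intro a b hab
    rw [Equiv.symm_apply_eq]
    simp only [φ, quotEquiv_mk, supportProj_apply, QuotientGroup.mk_mul]
  · intro p q r
    simp [mul_assoc]
  · simp
  · simp
  · simp
  · simp
  · rw [Equiv.symm_apply_eq]
    simp only [φ, quotEquiv_mk]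
    exact congrArg QuotientGroup.mk (supportProj_of_mem h hD1 1 _).symm
  · intro a b hb hbmem
    rw [Equiv.symm_apply_eq]
    simp only [φ, quotEquiv_mk]
    rw [supportProj_of_mem_invSet h hD1 a ⟨b, hbmem⟩ hb, QuotientGroup.mk_inv]

end PartialGroup
end

section
/- (Second isomorphism theorem for partial groups) Let H and K be partial subgroups of G = E·D with supports F = E ∩ H and F' = E ∩ K, and suppose K is a normal partial subgroup of G. Then F' is a normal subgroup of E, the set F*F' = {x*y : x ∈ F, y ∈ F'} is a subgroup of E containing F' as a normal subgroup, H ∩ K is a normal partial subgroup of H, and the map sending the ~_{H∩K}-class of h ∈ H to the left coset (h.e)*F' in the quotient group (F*F')/F' is a well-defined multiplicative bijection from H/~_{H∩K} onto (F*F')/F'. -/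
namespace PartialGroup

variable {Γ : Type*} [Group Γ]

/-- The support `E ∩ H` of a partial subgroup `H`, as a subgroup. -/
def support (E Dt : Subgroup Γ) (hint : (E : Set Γ) ∩ (Dt : Set Γ) = {1})
    (D : Set Γ) (hD1 : (1 : Γ) ∈ D) (hDsub : D ⊆ (Dt : Set Γ)) (pmul : Γ → Γ → Γ)
    (hpmul : ∀ x ∈ E, ∀ d ∈ D, ∀ y ∈ E, ∀ d' ∈ D, pmul (x * d) (y * d') = x * y)
    (H : Set Γ) (hH : IsPartialSubgroup E D pmul H) : Subgroup Γ where
  carrier := (E : Set Γ) ∩ H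
  one_mem' := ⟨E.one_mem, hH.2.1⟩
  mul_mem' := by
    rintro a b ⟨haE, haH⟩ ⟨hbE, hbH⟩
    have h := hH.2.2.1 a haH b hbH
    have hab := hpmul a haE 1 hD1 b hbE 1 hD1
    rw [mul_one, mul_one] at hab
    exact ⟨E.mul_mem haE hbE, hab ▸ h⟩
  inv_mem' := by
    rintro a ⟨haE, haH⟩
    obtain ⟨_, ⟨x, hx, d, hd, hxd, d', hd', rfl⟩, hgH⟩ := hH.2.2.2 a haH
    have hdE : d ∈ E := by
      rw [show d = x⁻¹ * a by rw [hxd, inv_mul_cancel_left]]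
      exact E.mul_mem (E.inv_mem hx) haE
    have hd_one : d = 1 := by
      have hmem : d ∈ (E : Set Γ) ∩ (Dt : Set Γ) := ⟨hdE, hDsub hd⟩
      rwa [hint] at hmem
    have h := hH.2.2.1 _ hgH 1 hH.2.1
    have hinv := hpmul x⁻¹ (E.inv_mem hx) d' hd' 1 E.one_mem 1 hD1
    rw [mul_one, mul_one] at hinv
    rw [hinv] at h
    rw [hxd, hd_one, mul_one]
    exact ⟨E.inv_mem hx, h⟩

/-- The `E`-component of an element of a partial subgroup `H` lies in `H`. -/
lemma IsPartialSubgroup.exists_decomposition {E : Subgroup Γ} {D : Set Γ} (hD1 : (1 : Γ) ∈ D)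
    {pmul : Γ → Γ → Γ}
    (hpmul : ∀ x ∈ E, ∀ d ∈ D, ∀ y ∈ E, ∀ d' ∈ D, pmul (x * d) (y * d') = x * y)
    {H : Set Γ} (hH : IsPartialSubgroup E D pmul H) {a : Γ} (ha : a ∈ H) :
    ∃ x ∈ (E : Set Γ) ∩ H, ∃ d ∈ D, a = x * d := by
  obtain ⟨x, hx, d, hd, rfl⟩ := hH.1 ha
  refine ⟨x, ⟨hx, ?_⟩, d, hd, rfl⟩
  have h := hH.2.2.1 _ ha 1 hH.2.1
  have hx_one := hpmul x hx d hd 1 E.one_mem 1 hD1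
  rw [mul_one, mul_one] at hx_one
  rwa [hx_one] at h

/-- Left cosets `s * N` and `t * N` of a subgroup agree iff `t⁻¹ * s ∈ N`. -/
lemma leftCoset_eq_iff (N : Subgroup Γ) (s t : Γ) :
    {g | ∃ y ∈ N, g = s * y} = {g | ∃ y ∈ N, g = t * y} ↔ t⁻¹ * s ∈ N := by
  constructor
  · intro h
    have hs : s ∈ {g | ∃ y ∈ N, g = s * y} := ⟨1, N.one_mem, (mul_one s).symm⟩
    rw [h] at hs
    obtain ⟨y, hy, rfl⟩ := hs
    rwa [inv_mul_cancel_left]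
  · intro h
    ext g
    constructor
    · rintro ⟨y, hy, rfl⟩
      exact ⟨t⁻¹ * s * y, N.mul_mem h hy, by group⟩
    · rintro ⟨y, hy, rfl⟩
      exact ⟨(t⁻¹ * s)⁻¹ * y, N.mul_mem (N.inv_mem h) hy, by group⟩

/-- **Second isomorphism theorem for partial groups.**
Let `H` and `K` be partial subgroups of `G = E·D` with supports `F = E ∩ H` and
`F' = E ∩ K`, and suppose `K` is a normal partial subgroup of `G`. Then `F'` is a normal
subgroup of `E`, the set `F*F' = {x*y : x ∈ F, y ∈ F'}` is a subgroup of `E` containing `F'`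
as a normal subgroup, `H ∩ K` is a normal partial subgroup of `H`, and the map sending the
`~_{H∩K}`-class of `h ∈ H` to the left coset `(h.e)*F'` in the quotient group `(F*F')/F'`
is a well-defined multiplicative bijection from `H/~_{H∩K}` onto `(F*F')/F'`. -/
theorem second_isomorphism
    (E Dt : Subgroup Γ)
    (hint : (E : Set Γ) ∩ (Dt : Set Γ) = {1})
    (hsupp : ∀ g : Γ, ∃ x ∈ E, ∃ d ∈ Dt, g = x * d)
    (D : Set Γ) (hD1 : (1 : Γ) ∈ D) (hDsub : D ⊆ (Dt : Set Γ))
    (pmul : Γ → Γ → Γ)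
    (hpmul : ∀ x ∈ E, ∀ d ∈ D, ∀ y ∈ E, ∀ d' ∈ D, pmul (x * d) (y * d') = x * y)
    (H K : Set Γ)
    (hH : IsPartialSubgroup E D pmul H) (hK : IsPartialSubgroup E D pmul K)
    (hKnormal : ∀ a ∈ prodSet E D, lcoset pmul a K = rcoset pmul a K) :
    -- `F' = E ∩ K` is a normal subgroup of `E`
    (∃ F'sub : Subgroup Γ, (F'sub : Set Γ) = (E : Set Γ) ∩ K ∧ F'sub ≤ E ∧
      ∀ x ∈ E, ∀ y ∈ (E : Set Γ) ∩ K, x⁻¹ * y * x ∈ (E : Set Γ) ∩ K) ∧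
    -- `F*F'` is a subgroup of `E` containing `F'` as a normal subgroup
    (∃ S : Subgroup Γ,
      (S : Set Γ) = {g | ∃ x ∈ (E : Set Γ) ∩ H, ∃ y ∈ (E : Set Γ) ∩ K, g = x * y} ∧
      S ≤ E ∧ (E : Set Γ) ∩ K ⊆ (S : Set Γ) ∧
      ∀ s ∈ S, ∀ y ∈ (E : Set Γ) ∩ K, s⁻¹ * y * s ∈ (E : Set Γ) ∩ K) ∧
    -- `H ∩ K` is a normal partial subgroup of `H`
    ((1 : Γ) ∈ H ∩ K ∧
      (∀ a ∈ H ∩ K, ∀ b ∈ H ∩ K, pmul a b ∈ H ∩ K) ∧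
      (∀ a ∈ H ∩ K, (invSet E D a ∩ (H ∩ K)).Nonempty) ∧
      (∀ h ∈ H, lcoset pmul h (H ∩ K) = rcoset pmul h (H ∩ K))) ∧
    -- the natural map `H/~_{H∩K} → (F*F')/F'`, `[h] ↦ (h.e)*F'`, is a well-defined
    -- multiplicative bijection
    ∃ φ : Quot (simRelN pmul (H ∩ K) H) → Set Γ,
      (∀ h : ↥H, φ (Quot.mk _ h) = {g | ∃ y ∈ (E : Set Γ) ∩ K, g = pmul (h : Γ) 1 * y}) ∧
      Function.Injective φ ∧
      Set.range φ = {C | ∃ s ∈ {g | ∃ x ∈ (E : Set Γ) ∩ H, ∃ y ∈ (E : Set Γ) ∩ K, g = x * y},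
                      C = {g | ∃ y ∈ (E : Set Γ) ∩ K, g = s * y}} ∧
      (∀ (h h' : ↥H) (hm : pmul (h : Γ) (h' : Γ) ∈ H),
        φ (Quot.mk _ (⟨pmul (h : Γ) (h' : Γ), hm⟩ : ↥H)) =
          {g | ∃ y ∈ (E : Set Γ) ∩ K, g = pmul (h : Γ) 1 * pmul (h' : Γ) 1 * y}) := by
  let F := support E Dt hint D hD1 hDsub pmul hpmul H hH
  let N := support E Dt hint D hD1 hDsub pmul hpmul K hK
  have hFE : ∀ {x}, x ∈ F → x ∈ E := fun h => h.1
  have hNE : ∀ {x}, x ∈ N → x ∈ E := fun h => h.1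
  have hdecH : ∀ a ∈ H, ∃ x ∈ F, ∃ d ∈ D, a = x * d :=
    fun a ha => hH.exists_decomposition hD1 hpmul ha
  have hdecK : ∀ a ∈ K, ∃ x ∈ N, ∃ d ∈ D, a = x * d :=
    fun a ha => hK.exists_decomposition hD1 hpmul ha
  have hpmul_left : ∀ x ∈ E, ∀ d ∈ D, ∀ y ∈ E, pmul (x * d) y = x * y := by
    intro x hx d hd y hy
    simpa using hpmul x hx d hd y hy 1 hD1
  have hpmul_right : ∀ x ∈ E, ∀ y ∈ E, ∀ d ∈ D, pmul x (y * d) = x * y := by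
    intro x hx y hy d hd
    simpa using hpmul x hx 1 hD1 y hy d hd
  have hpmul_one : ∀ x ∈ E, ∀ d ∈ D, pmul (x * d) 1 = x := by
    intro x hx d hd
    simpa using hpmul_left x hx d hd 1 E.one_mem
  have hnormal : ∀ x ∈ E, ∀ y ∈ N, x⁻¹ * y * x ∈ N := by
    intro x hx y hy
    have hmem : y * x ∈ rcoset pmul x K :=
      ⟨y, hy.2, by simpa using (hpmul_right y (hNE hy) x hx 1 hD1).symm⟩
    rw [← hKnormal x ⟨x, hx, 1, hD1, (mul_one x).symm⟩] at hmem
    obtain ⟨k, hk, hyx⟩ := hmem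
    obtain ⟨z, hz, d, hd, rfl⟩ := hdecK k hk
    rw [hpmul_right x hx z (hNE hz) d hd] at hyx
    rwa [mul_assoc, hyx, inv_mul_cancel_left]
  have hnormal_inv : ∀ x ∈ E, ∀ y ∈ N, x * y * x⁻¹ ∈ N := by
    intro x hx y hy
    simpa using hnormal x⁻¹ (E.inv_mem hx) y hy
  let S : Subgroup Γ :=
    { carrier := {g | ∃ x ∈ F, ∃ y ∈ N, g = x * y}
      one_mem' := ⟨1, F.one_mem, 1, N.one_mem, (mul_one 1).symm⟩
      mul_mem' := by
        rintro _ _ ⟨x, hx, y, hy, rfl⟩ ⟨x', hx', y', hy', rfl⟩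
        exact ⟨x * x', F.mul_mem hx hx', x'⁻¹ * y * x' * y',
          N.mul_mem (hnormal x' (hFE hx') y hy) hy', by group⟩
      inv_mem' := by
        rintro _ ⟨x, hx, y, hy, rfl⟩
        exact ⟨x⁻¹, F.inv_mem hx, x * y⁻¹ * x⁻¹,
          hnormal_inv x (hFE hx) _ (N.inv_mem hy), by group⟩ }
  have hSE : S ≤ E := by
    rintro _ ⟨x, hx, y, hy, rfl⟩
    exact E.mul_mem (hFE hx) (hNE hy)
  refine ⟨⟨N, rfl, fun _ => hNE, hnormal⟩,
    ⟨S, rfl, hSE, fun y hy => ⟨1, F.one_mem, y, hy, (one_mul y).symm⟩,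
      fun s hs => hnormal s (hSE hs)⟩,
    ⟨⟨hH.2.1, hK.2.1⟩,
      fun a ha b hb => ⟨hH.2.2.1 a ha.1 b hb.1, hK.2.2.1 a ha.2 b hb.2⟩, ?_, ?_⟩, ?_⟩
  · rintro a ⟨haH, haK⟩
    obtain ⟨x, hx, d, hd, rfl⟩ := hdecH a haH
    have hxK : x ∈ N := by
      have h := hK.2.2.1 _ haK 1 hK.2.1
      rw [hpmul_one x (hFE hx) d hd] at h
      exact ⟨hFE hx, h⟩
    exact ⟨x⁻¹, ⟨x, hFE hx, d, hd, rfl, 1, hD1, (mul_one _).symm⟩,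
      (F.inv_mem hx).2, (N.inv_mem hxK).2⟩
  · intro h hh
    obtain ⟨x, hx, d, hd, rfl⟩ := hdecH h hh
    have hdecHK : ∀ k ∈ H ∩ K, ∃ y, y ∈ F ∧ y ∈ N ∧ ∃ d ∈ D, k = y * d := by
      rintro k ⟨hkH, hkK⟩
      obtain ⟨y, hy, d', hd', rfl⟩ := hdecK k hkK
      have hyH := hH.2.2.1 _ hkH 1 hH.2.1
      rw [hpmul_one y (hNE hy) d' hd'] at hyH
      exact ⟨y, ⟨hNE hy, hyH⟩, hy, d', hd', rfl⟩
    ext g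
    constructor
    · rintro ⟨k, hk, rfl⟩
      obtain ⟨y, hyF, hyN, d', hd', rfl⟩ := hdecHK k hk
      have hconjF : x * y * x⁻¹ ∈ F := F.mul_mem (F.mul_mem hx hyF) (F.inv_mem hx)
      refine ⟨x * y * x⁻¹, ⟨hconjF.2, (hnormal_inv x (hFE hx) y hyN).2⟩, ?_⟩
      rw [hpmul x (hFE hx) d hd y (hFE hyF) d' hd',
        hpmul_right _ (hFE hconjF) x (hFE hx) d hd, inv_mul_cancel_right]
    · rintro ⟨k, hk, rfl⟩
      obtain ⟨y, hyF, hyN, d', hd', rfl⟩ := hdecHK k hk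
      have hconjF : x⁻¹ * y * x ∈ F := F.mul_mem (F.mul_mem (F.inv_mem hx) hyF) hx
      refine ⟨x⁻¹ * y * x, ⟨hconjF.2, (hnormal x (hFE hx) y hyN).2⟩, ?_⟩
      rw [hpmul y (hFE hyF) d' hd' x (hFE hx) d hd,
        hpmul_left x (hFE hx) d hd _ (hFE hconjF)]
      group
  · let coset : Γ → Set Γ := fun s => {g | ∃ y ∈ N, g = s * y}
    have hcoset : ∀ s t, coset s = coset t ↔ t⁻¹ * s ∈ N := leftCoset_eq_iff N
    refine ⟨Quot.lift (fun h : ↥H => coset (pmul (h : Γ) 1)) ?_, fun _ => rfl, ?_, ?_, ?_⟩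
    · rintro ⟨a, ha⟩ ⟨b, hb⟩ ⟨k, hk, hab⟩
      obtain ⟨y, hy, d, hd, rfl⟩ := hdecH b hb
      obtain ⟨z, hz, d', hd', rfl⟩ := hdecK k hk.2
      dsimp only at hab ⊢
      rw [hpmul y (hFE hy) d hd z (hNE hz) d' hd'] at hab
      rw [hcoset, hab, hpmul_one y (hFE hy) d hd, inv_mul_cancel_left]
      exact hz
    · rintro ⟨a, ha⟩ ⟨b, hb⟩ hab
      obtain ⟨x, hx, d, hd, rfl⟩ := hdecH a ha
      obtain ⟨y, hy, d', hd', rfl⟩ := hdecH b hb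
      have hmem := (hcoset _ _).1 hab
      dsimp only at hmem
      rw [hpmul_one x (hFE hx) d hd, hpmul_one y (hFE hy) d' hd'] at hmem
      refine Quot.sound ⟨y⁻¹ * x, ⟨(F.mul_mem (F.inv_mem hy) hx).2, hmem.2⟩, ?_⟩
      dsimp only
      rw [hpmul_one x (hFE hx) d hd, hpmul_left y (hFE hy) d' hd' _ (hNE hmem),
        mul_inv_cancel_left]
    · ext C
      constructor
      · rintro ⟨⟨a, ha⟩, rfl⟩
        exact ⟨pmul a 1, by
          obtain ⟨x, hx, d, hd, rfl⟩ := hdecH a ha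
          rw [hpmul_one x (hFE hx) d hd]
          exact ⟨x, hx, 1, N.one_mem, (mul_one x).symm⟩, rfl⟩
      · rintro ⟨_, ⟨x, hx, y, hy, rfl⟩, rfl⟩
        refine ⟨Quot.mk _ ⟨x, hx.2⟩, (hcoset _ _).2 ?_⟩
        have hx_one : pmul x 1 = x := by simpa using hpmul_one x hx.1 1 hD1
        dsimp only
        rw [hx_one]
        have hyinv : y⁻¹ ∈ N := N.inv_mem hy
        simpa using hyinv
    · rintro ⟨a, ha⟩ ⟨b, hb⟩ hm
      obtain ⟨x, hx, d, hd, rfl⟩ := hdecH a ha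
      obtain ⟨y, hy, d', hd', rfl⟩ := hdecH b hb
      have hxy : pmul (x * y) 1 = x * y := by
        simpa using hpmul_one (x * y) (E.mul_mem (hFE hx) (hFE hy)) 1 hD1
      change coset (pmul (pmul (x * d) (y * d')) 1) =
        coset (pmul (x * d) 1 * pmul (y * d') 1)
      rw [hpmul x (hFE hx) d hd y (hFE hy) d' hd', hxy, hpmul_one x (hFE hx) d hd,
        hpmul_one y (hFE hy) d' hd']

end PartialGroup
end
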